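/- For every type domain (X, Y, r) with X Y : Type u and r : X → Y → Prop, the diagram context over the table category Tbl(X,Y,r) (the context of relational (X,Y,r)-databases) has all limits and all colimits indexed by small categories, and its projection functor to Catᵒᵖ, sending (B, D) to B, preserves all such limits and colimits. -/

import Mathlib

open CategoryTheory CategoryTheory.Limits

universe w v₀ u₀ u

/-- The tuple functor of a type domain `(X, Y, r)`: it sends an `X`-sorted signature
`(I, s : I → X)` to the set of `r`-compatible `Y`-valued tuples on `I`, contravariantly. -/
@[simps]
def tup {X : Type u} (Y : Type u) (r : X → Y → Prop) : (Over X)ᵒᵖ ⥤ Type u where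
  obj S := { t : S.unop.left → Y // ∀ i, r (S.unop.hom i) (t i) }
  map {S₁ S₂} h := TypeCat.ofHom fun t =>
    ⟨fun i => t.1 (h.unop.left i), fun i => by
      have h1 := ConcreteCategory.congr_hom (Over.w h.unop) i
      dsimp at h1
      rw [← h1]
      exact t.2 _⟩
  map_id S := ConcreteCategory.hom_ext _ _ fun t => Subtype.ext rfl
  map_comp f g := ConcreteCategory.hom_ext _ _ fun t => Subtype.ext rfl

/-- The diagram context over `A`: the strict functor `Catᵒᵖ ⥤ Cat` sending a small category
`B` to the functor category `B ⥤ A`, and a functor `K : B₂ ⥤ B₁` (a morphism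
`op B₁ ⟶ op B₂` of `Catᵒᵖ`) to the precomposition (left-whiskering) functor
`(B₁ ⥤ A) ⥤ (B₂ ⥤ A)`. -/
@[simps]
def diagramContextFunctor (A : Type u₀) [Category.{v₀} A] :
    Cat.{w, w}ᵒᵖ ⥤ Cat.{max w v₀, max w v₀ u₀} where
  obj B := Cat.of (B.unop ⥤ A)
  map {B₁ B₂} K := ((Functor.whiskeringLeft B₂.unop B₁.unop A).obj K.unop.toFunctor).toCatHom

universe vC vE vF uC uE uF

/-- A bifibration `p : E ⥤ C` presented by explicit fiber categories. -/
structure BifibData {E : Type uE} [Category.{vE} E] {C : Type uC} [Category.{vC} C] (p : E ⥤ C)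
    (Fib : C → Type uF) [∀ c, Category.{vF} (Fib c)] where
  ι : ∀ c, Fib c ⥤ E
  e : ∀ {c} (x : Fib c), p.obj ((ι c).obj x) ≅ c
  e_nat : ∀ {c} {x y : Fib c} (v : x ⟶ y), p.map ((ι c).map v) ≫ (e y).hom = (e x).hom
  full : ∀ {c} {x y : Fib c} (w : (ι c).obj x ⟶ (ι c).obj y),
    p.map w ≫ (e y).hom = (e x).hom → ∃ v, (ι c).map v = w
  faithful : ∀ {c} {x y : Fib c} (v w : x ⟶ y), (ι c).map v = (ι c).map w → v = w
  cart : ∀ (a : E) (c : C) (f : c ⟶ p.obj a), ∃ (x : Fib c) (φ : (ι c).obj x ⟶ a),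
    p.map φ = (e x).hom ≫ f ∧ ∀ (z : E) (ψ : z ⟶ a) (g : p.obj z ⟶ c), p.map ψ = g ≫ f →
      ∃! χ : z ⟶ (ι c).obj x, p.map χ ≫ (e x).hom = g ∧ χ ≫ φ = ψ
  cocart : ∀ (a : E) (c : C) (f : p.obj a ⟶ c), ∃ (x : Fib c) (φ : a ⟶ (ι c).obj x),
    p.map φ ≫ (e x).hom = f ∧ ∀ (z : E) (ψ : a ⟶ z) (g : c ⟶ p.obj z), p.map ψ = f ≫ g →
      ∃! χ : (ι c).obj x ⟶ z, p.map χ = (e x).hom ≫ g ∧ φ ≫ χ = ψ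

namespace BifibData

variable {E : Type uE} [Category.{vE} E] {C : Type uC} [Category.{vC} C] {p : E ⥤ C}
    {Fib : C → Type uF} [∀ c, Category.{vF} (Fib c)]

/-- The opposite bifibration. -/
def op (d : BifibData p Fib) : BifibData p.op (fun c => (Fib c.unop)ᵒᵖ) where
  ι c := (d.ι c.unop).op
  e x := (d.e x.unop).op.symm
  e_nat {c x y} v := by
    apply Quiver.Hom.unop_inj
    have := d.e_nat v.unop
    simp only [Functor.op_map, Iso.symm_hom, Iso.op_inv, unop_comp, Quiver.Hom.unop_op]
    rw [Iso.inv_comp_eq, ← this]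
    simp
  full {c x y} w h := by
    have h2 := congrArg Quiver.Hom.unop h
    simp only [Functor.op_map, Iso.symm_hom, Iso.op_inv, unop_comp, Quiver.Hom.unop_op] at h2
    rw [Iso.inv_comp_eq] at h2
    obtain ⟨v, hv⟩ := d.full w.unop (by
      have h3 := congrArg (fun t => t ≫ (d.e x.unop).hom) h2
      simpa using h3)
    exact ⟨v.op, Quiver.Hom.unop_inj hv⟩
  faithful {c x y} v w h :=
    Quiver.Hom.unop_inj (d.faithful _ _ (congrArg Quiver.Hom.unop h))
  cart a c f := by
    obtain ⟨x, φ, h1, h2⟩ := d.cocart a.unop c.unop f.unop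
    refine ⟨Opposite.op x, φ.op, ?_, ?_⟩
    · apply Quiver.Hom.unop_inj
      change p.map φ = f.unop ≫ (d.e x).inv
      rw [Iso.eq_comp_inv, h1]
    · intro z ψ g hg
      obtain ⟨χ, ⟨hχ, hχ'⟩, hu⟩ := h2 z.unop ψ.unop g.unop (congrArg Quiver.Hom.unop hg)
      refine ⟨χ.op, ⟨?_, ?_⟩, ?_⟩
      · apply Quiver.Hom.unop_inj
        change (d.e x).inv ≫ p.map χ = g.unop
        rw [Iso.inv_comp_eq, hχ]
      · exact Quiver.Hom.unop_inj hχ'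
      · rintro χ' ⟨k1, k2⟩
        apply Quiver.Hom.unop_inj
        apply hu
        refine ⟨?_, congrArg Quiver.Hom.unop k2⟩
        have k3 : (d.e x).inv ≫ p.map χ'.unop = g.unop := congrArg Quiver.Hom.unop k1
        rwa [Iso.inv_comp_eq] at k3
  cocart a c f := by
    obtain ⟨x, φ, h1, h2⟩ := d.cart a.unop c.unop f.unop
    refine ⟨Opposite.op x, φ.op, ?_, ?_⟩
    · apply Quiver.Hom.unop_inj
      change (d.e x).inv ≫ p.map φ = f.unop
      rw [Iso.inv_comp_eq, h1]
    · intro z ψ g hg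
      obtain ⟨χ, ⟨hχ, hχ'⟩, hu⟩ := h2 z.unop ψ.unop g.unop (congrArg Quiver.Hom.unop hg)
      refine ⟨χ.op, ⟨?_, ?_⟩, ?_⟩
      · apply Quiver.Hom.unop_inj
        change p.map χ = g.unop ≫ (d.e x).inv
        rw [Iso.eq_comp_inv, hχ]
      · exact Quiver.Hom.unop_inj hχ'
      · rintro χ' ⟨k1, k2⟩
        apply Quiver.Hom.unop_inj
        apply hu
        refine ⟨?_, congrArg Quiver.Hom.unop k2⟩
        have k3 : p.map χ'.unop = g.unop ≫ (d.e x).inv := congrArg Quiver.Hom.unop k1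
        rwa [Iso.eq_comp_inv] at k3

universe vJ uJ

/-- A limit cone over `H` whose image under `p` is a limit cone. -/
lemma exists_limit (d : BifibData p Fib) {J : Type uJ} [Category.{vJ} J]
    [HasLimitsOfShape J C] [∀ c, HasLimitsOfShape J (Fib c)] (H : J ⥤ E) :
    ∃ t : Cone H, Nonempty (IsLimit t) ∧ Nonempty (IsLimit (p.mapCone t)) := by
  let s := limit.cone (H ⋙ p)
  have hs : IsLimit s := limit.isLimit _
  choose x φ hφ hφu using fun j => d.cart (H.obj j) s.pt (s.π.app j)
  -- uniqueness for maps into the cartesian lifts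
  have cext : ∀ {z : E} {j : J} (χ χ' : z ⟶ (d.ι s.pt).obj (x j)),
      p.map χ ≫ (d.e (x j)).hom = p.map χ' ≫ (d.e (x j)).hom → χ ≫ φ j = χ' ≫ φ j → χ = χ' := by
    intro z j χ χ' h1 h2
    obtain ⟨_, _, hu⟩ := hφu j z (χ' ≫ φ j) (p.map χ' ≫ (d.e (x j)).hom) (by simp [hφ])
    rw [hu χ ⟨h1, h2⟩, hu χ' ⟨rfl, rfl⟩]
  have hv : ∀ {j k : J} (f : j ⟶ k), ∃ v : x j ⟶ x k,
      (d.ι s.pt).map v ≫ φ k = φ j ≫ H.map f := by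
    intro j k f
    obtain ⟨χ, ⟨h1, h2⟩, -⟩ := hφu k _ (φ j ≫ H.map f) (d.e (x j)).hom (by
      have := s.w f
      simp only [Functor.comp_map] at this
      simp [hφ, ← this])
    obtain ⟨v, rfl⟩ := d.full χ h1
    exact ⟨v, h2⟩
  choose v hv using @hv
  have vext : ∀ {y : Fib s.pt} {j : J} (a b : y ⟶ x j),
      (d.ι s.pt).map a ≫ φ j = (d.ι s.pt).map b ≫ φ j → a = b := by
    intro y j a b h
    exact d.faithful _ _ (cext _ _ (by rw [d.e_nat, d.e_nat]) h)
  let L : J ⥤ Fib s.pt :=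
    { obj := x
      map := fun f => v f
      map_id := fun j => vext _ _ (by simp [hv])
      map_comp := fun f g => vext _ _ (by
        rw [hv, (d.ι s.pt).map_comp, Category.assoc, hv, ← Category.assoc, hv, Category.assoc,
          H.map_comp]) }
  let t := limit.cone L
  have ht : IsLimit t := limit.isLimit _
  let T : Cone H :=
    { pt := (d.ι s.pt).obj t.pt
      π := { app := fun j => (d.ι s.pt).map (t.π.app j) ≫ φ j
             naturality := fun j k f => by
              have h := t.w f
              change t.π.app j ≫ v f = t.π.app k at h
              simp [← h, hv] } }
  have hT : ∀ j, p.map (T.π.app j) = (d.e t.pt).hom ≫ s.π.app j := by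
    intro j
    change p.map ((d.ι s.pt).map (t.π.app j) ≫ φ j) = _
    rw [p.map_comp, hφ, ← Category.assoc, d.e_nat]
    rfl
  refine ⟨T, ⟨?_⟩, ⟨?_⟩⟩
  · have key : ∀ z : Cone H, ∃! m : z.pt ⟶ T.pt, ∀ j, m ≫ T.π.app j = z.π.app j := by
      intro z
      let g : p.obj z.pt ⟶ s.pt := hs.lift (p.mapCone z)
      have hg : ∀ j, p.map (z.π.app j) = g ≫ s.π.app j := fun j =>
        (hs.fac (p.mapCone z) j).symm
      choose χ hχ _ using fun j => hφu j z.pt (z.π.app j) g (hg j)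
      obtain ⟨y, γ, hγ, hγu⟩ := d.cocart z.pt s.pt g
      have gext : ∀ {b : Fib s.pt} (l l' : y ⟶ b),
          γ ≫ (d.ι s.pt).map l = γ ≫ (d.ι s.pt).map l' → l = l' := by
        intro b l l' h
        obtain ⟨_, _, hu⟩ := hγu _ (γ ≫ (d.ι s.pt).map l') (d.e b).inv (by
          rw [Iso.eq_comp_inv, p.map_comp, Category.assoc, d.e_nat, hγ])
        apply d.faithful
        rw [hu _ ⟨by rw [Iso.eq_comp_inv, d.e_nat], h⟩,
          hu ((d.ι s.pt).map l') ⟨by rw [Iso.eq_comp_inv, d.e_nat], rfl⟩]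
      have gex : ∀ {b : Fib s.pt} (m : z.pt ⟶ (d.ι s.pt).obj b),
          p.map m ≫ (d.e b).hom = g → ∃ l : y ⟶ b, γ ≫ (d.ι s.pt).map l = m := by
        intro b m h
        obtain ⟨δ, ⟨h1, h2⟩, _⟩ := hγu _ m (d.e b).inv (by rw [Iso.eq_comp_inv, h])
        obtain ⟨l, rfl⟩ := d.full δ (by rw [h1]; simp)
        exact ⟨l, h2⟩
      choose w hw using fun j => gex (χ j) (hχ j).1
      let W : Cone L :=
        { pt := y
          π := { app := w
                 naturality := fun j k f => by
                  change 𝟙 y ≫ w k = w j ≫ v f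
                  rw [Category.id_comp]
                  apply gext
                  rw [Functor.map_comp, ← Category.assoc, hw, hw]
                  apply cext
                  · rw [p.map_comp, Category.assoc, d.e_nat, (hχ j).1, (hχ k).1]
                  · rw [Category.assoc, hv, ← Category.assoc, (hχ j).2, (hχ k).2, z.w] } }
      refine ⟨γ ≫ (d.ι s.pt).map (ht.lift W), ?_, ?_⟩
      · intro j
        change (γ ≫ (d.ι s.pt).map (ht.lift W)) ≫ (d.ι s.pt).map (t.π.app j) ≫ φ j = _
        rw [Category.assoc, ← Functor.map_comp_assoc, ht.fac]
        change γ ≫ (d.ι s.pt).map (w j) ≫ φ j = _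
        rw [← Category.assoc, hw, (hχ j).2]
      · intro m hm
        have hpm : p.map m ≫ (d.e t.pt).hom = g := by
          apply hs.hom_ext
          intro j
          rw [Category.assoc, ← hT, ← hg, ← hm]
          exact (p.map_comp _ _).symm
        obtain ⟨l, rfl⟩ := gex m hpm
        congr 2
        apply ht.uniq W
        intro j
        change l ≫ t.π.app j = w j
        apply gext
        rw [hw]
        apply cext
        · rw [(hχ j).1, p.map_comp, Category.assoc, d.e_nat, hγ]
        · rw [(hχ j).2, ← hm j, Functor.map_comp, Category.assoc, Category.assoc, Category.assoc]
    choose m hm hu using key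
    exact { lift := m, fac := hm, uniq := hu }
  · exact hs.ofIsoLimit (Cone.ext (d.e t.pt) hT).symm

lemma hasLimitsOfSize (d : BifibData p Fib) [HasLimitsOfSize.{vJ, uJ} C]
    [∀ c, HasLimitsOfSize.{vJ, uJ} (Fib c)] :
    HasLimitsOfSize.{vJ, uJ} E ∧ PreservesLimitsOfSize.{vJ, uJ} p := by
  refine ⟨⟨fun J _ => ⟨fun H => ?_⟩⟩, ⟨fun {J} _ => ⟨fun {H} => ?_⟩⟩⟩
  · obtain ⟨t, ⟨ht⟩, -⟩ := d.exists_limit H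
    exact ⟨⟨t, ht⟩⟩
  · obtain ⟨t, ⟨ht⟩, ⟨ht'⟩⟩ := d.exists_limit H
    exact preservesLimit_of_preserves_limit_cone ht ht'

lemma hasColimitsOfSize (d : BifibData p Fib) [HasColimitsOfSize.{vJ, uJ} C]
    [∀ c, HasColimitsOfSize.{vJ, uJ} (Fib c)] :
    HasColimitsOfSize.{vJ, uJ} E ∧ PreservesColimitsOfSize.{vJ, uJ} p := by
  obtain ⟨h1, h2⟩ := hasLimitsOfSize.{_, _, _, _, _, _, vJ, uJ} d.op
  exact ⟨hasColimits_of_hasLimits_op, preservesColimitsOfSize_of_op p⟩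

end BifibData
section

variable {C : Type uC} [Category.{vC} C] (F : C ⥤ Cat.{vF, uF})

lemma map_fiber_comp {a b c : C} (g : a ⟶ b) (f : b ⟶ c) (w : F.obj a) :
    (F.map (g ≫ f)).toFunctor.obj w = (F.map f).toFunctor.obj ((F.map g).toFunctor.obj w) := by
  simp

lemma mk_eq_mk_iff {a b : C} {x : F.obj a} {y : F.obj b} (f : a ⟶ b)
    (α β : (F.map f).toFunctor.obj x ⟶ y) :
    (Grothendieck.Hom.mk f α : (⟨a, x⟩ : Grothendieck F) ⟶ ⟨b, y⟩) = Grothendieck.Hom.mk f β ↔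
      α = β := by
  constructor
  · intro h
    exact eq_of_heq (Grothendieck.Hom.mk.inj h).2
  · rintro rfl
    rfl

lemma mk_comp_eq_iff {a b c : C} {x : F.obj a} {y : F.obj b} {z : F.obj c} (f : a ⟶ b)
    (α : (F.map f).toFunctor.obj x ⟶ y) (g : b ⟶ c) (β : (F.map g).toFunctor.obj y ⟶ z)
    (γ : (F.map (f ≫ g)).toFunctor.obj x ⟶ z) :
    @CategoryStruct.comp (Grothendieck F) _ ⟨a, x⟩ ⟨b, y⟩ ⟨c, z⟩
      (Grothendieck.Hom.mk f α) (Grothendieck.Hom.mk g β) = Grothendieck.Hom.mk (f ≫ g) γ ↔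
      (F.map g).toFunctor.map α ≫ β = eqToHom (map_fiber_comp F f g x).symm ≫ γ := by
  refine (mk_eq_mk_iff F (f ≫ g)
    (eqToHom (map_fiber_comp F f g x) ≫ (F.map g).toFunctor.map α ≫ β) γ).trans ?_
  constructor
  · rintro rfl
    simp
  · intro h
    rw [h]
    simp

lemma map_id_comp_eq {a b : C} (f : a ⟶ b) (x : F.obj a) {y : F.obj b}
    (α : (F.map f).toFunctor.obj x ⟶ y) : (F.map f).toFunctor.map (𝟙 x) ≫ α = α := by
  simp

lemma map_id_obj' (c : C) (x : F.obj c) : (F.map (𝟙 c)).toFunctor.obj x = x := by simp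

/-- A Grothendieck construction whose transition functors are left adjoints is a bifibration. -/
noncomputable def grothendieckBifib [∀ {a b : C} (f : a ⟶ b), (F.map f).toFunctor.IsLeftAdjoint] :
    BifibData (Grothendieck.forget F) (fun c => F.obj c) where
  ι c := Grothendieck.ι F c
  e {c} x := Iso.refl c
  e_nat {c x y} v := Category.comp_id (𝟙 c)
  full {c x y} w h := by
    obtain ⟨b, fb⟩ := w
    have hb : b = 𝟙 c := (Category.comp_id (X := c) (Y := c) b).symm.trans h
    subst hb
    change (F.map (𝟙 c)).toFunctor.obj x ⟶ y at fb
    refine ⟨eqToHom (map_id_obj' F c x).symm ≫ fb, ?_⟩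
    refine (mk_eq_mk_iff F (𝟙 c)
      (eqToHom (map_id_obj' F c x) ≫ eqToHom (map_id_obj' F c x).symm ≫ fb) fb).2 ?_
    simp
  faithful {c x y} v w h := by
    have h2 := (mk_eq_mk_iff F (𝟙 c) (eqToHom (map_id_obj' F c x) ≫ v)
      (eqToHom (map_id_obj' F c x) ≫ w)).1 h
    exact (cancel_epi _).1 h2
  cart := by
    rintro ⟨a, y⟩ c f
    change c ⟶ a at f
    let adj := Adjunction.ofIsLeftAdjoint (F.map f).toFunctor
    refine ⟨(F.map f).toFunctor.rightAdjoint.obj y, Grothendieck.Hom.mk f (adj.counit.app y),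
      (Category.id_comp f).symm, ?_⟩
    rintro ⟨z, w⟩ ⟨b, ψ⟩ g hg
    change z ⟶ c at g
    change b = g ≫ f at hg
    subst hg
    change (F.map (g ≫ f)).toFunctor.obj w ⟶ y at ψ
    refine ⟨Grothendieck.Hom.mk g
      (adj.homEquiv _ _ (eqToHom (map_fiber_comp F g f w).symm ≫ ψ)),
      ⟨Category.comp_id g, ?_⟩, ?_⟩
    · refine (mk_comp_eq_iff F g _ f (adj.counit.app y) ψ).2 ?_
      exact (adj.homEquiv_counit ((F.map g).toFunctor.obj w) y _).symm.trans
        (Equiv.symm_apply_apply _ _)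
    · rintro ⟨b', χ⟩ ⟨h1, h2⟩
      change z ⟶ c at b'
      have h3 : b' = g := (Category.comp_id b').symm.trans h1
      subst h3
      refine (mk_eq_mk_iff F b' _ _).2 ?_
      have h4 := (mk_comp_eq_iff F b' χ f (adj.counit.app y) ψ).1 h2
      have h5 := (adj.homEquiv_counit (X := (F.map b').toFunctor.obj w) (g := χ)).trans h4
      exact (Equiv.symm_apply_eq _).1 h5
  cocart := by
    rintro ⟨a, y⟩ c f
    change a ⟶ c at f
    refine ⟨(F.map f).toFunctor.obj y, Grothendieck.Hom.mk f (𝟙 _), Category.comp_id f, ?_⟩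
    rintro ⟨z, w⟩ ⟨b, ψ⟩ g hg
    change c ⟶ z at g
    change b = f ≫ g at hg
    subst hg
    change (F.map (f ≫ g)).toFunctor.obj y ⟶ w at ψ
    refine ⟨Grothendieck.Hom.mk g (eqToHom (map_fiber_comp F f g y).symm ≫ ψ),
      ⟨(Category.id_comp g).symm, ?_⟩, ?_⟩
    · refine (mk_comp_eq_iff F f (𝟙 _) g _ ψ).2 ?_
      exact map_id_comp_eq F g _ _
    · rintro ⟨b', χ⟩ ⟨h1, h2⟩
      change c ⟶ z at b'
      have h3 : b' = g := h1.trans (Category.id_comp g)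
      subst h3
      refine (mk_eq_mk_iff F b' _ _).2 ?_
      have h4 := (mk_comp_eq_iff F f (𝟙 _) b' χ ψ).1 h2
      exact (map_id_comp_eq F b' _ χ).symm.trans h4

end

lemma tup_preservesLimits {X : Type u} (Y : Type u) (r : X → Y → Prop) :
    PreservesLimitsOfSize.{u, u} (tup Y r) := by
  let R : Over X := Over.mk (TypeCat.ofHom (fun q : {q : X × Y // r q.1 q.2} => q.1.1))
  let i : yoneda.obj R ≅ tup Y r := NatIso.ofComponents
    (fun S => Equiv.toIso
      { toFun := fun m => ⟨fun i => (m.left i).1.2, fun i => by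
          have h1 : (m.left i).1.1 = S.unop.hom i := by
            have h0 := ConcreteCategory.congr_hom (Over.w m) i
            exact h0
          rw [← h1]
          exact (m.left i).2⟩
        invFun := fun t => Over.homMk (TypeCat.ofHom (fun i => ⟨(S.unop.hom i, t.1 i), t.2 i⟩)) rfl
        left_inv := fun m => by
          apply Over.OverMorphism.ext
          apply ConcreteCategory.hom_ext
          intro i
          have h1 : (m.left i).1.1 = S.unop.hom i := by
            have h0 := ConcreteCategory.congr_hom (Over.w m) i
            exact h0
          exact Subtype.ext (Prod.ext h1.symm rfl)
        right_inv := fun t => rfl })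
    (fun f => rfl)
  exact preservesLimits_of_natIso i

/-- For every type domain `(X, Y, r)`, the diagram context over the table
category `Comma (𝟭 (Type u)) (tup Y r)` (the context of relational `(X,Y,r)`-databases)
has all limits and colimits indexed by small categories, and its projection to `Catᵒᵖ`
preserves all such limits and colimits. -/
theorem databaseContext_hasLimits_hasColimits_and_forget_preserves
    (X Y : Type u) (r : X → Y → Prop) :
    (HasLimitsOfSize.{u, u}
        (Grothendieck (diagramContextFunctor.{u} (Comma (𝟭 (Type u)) (tup Y r)))) ∧
      HasColimitsOfSize.{u, u}
        (Grothendieck (diagramContextFunctor.{u} (Comma (𝟭 (Type u)) (tup Y r))))) ∧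
    (PreservesLimitsOfSize.{u, u}
        (Grothendieck.forget (diagramContextFunctor.{u} (Comma (𝟭 (Type u)) (tup Y r)))) ∧
      PreservesColimitsOfSize.{u, u}
        (Grothendieck.forget (diagramContextFunctor.{u} (Comma (𝟭 (Type u)) (tup Y r))))) := by
  have := tup_preservesLimits Y r
  have hl : HasLimitsOfSize.{u, u} (Comma (𝟭 (Type u)) (tup Y r)) := inferInstance
  have hc : HasColimitsOfSize.{u, u} (Comma (𝟭 (Type u)) (tup Y r)) := inferInstance
  have hadj : ∀ {a b : Cat.{u, u}ᵒᵖ} (f : a ⟶ b),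
      ((diagramContextFunctor.{u} (Comma (𝟭 (Type u)) (tup Y r))).map f).toFunctor.IsLeftAdjoint :=
    fun f => (f.unop.toFunctor.ranAdjunction (Comma (𝟭 (Type u)) (tup Y r))).isLeftAdjoint
  let d := grothendieckBifib (diagramContextFunctor.{u} (Comma (𝟭 (Type u)) (tup Y r)))
  have h1 : ∀ c : Cat.{u, u}ᵒᵖ, HasLimitsOfSize.{u, u}
      ((diagramContextFunctor.{u} (Comma (𝟭 (Type u)) (tup Y r))).obj c) := fun c =>
    inferInstanceAs (HasLimitsOfSize.{u, u} (c.unop ⥤ Comma (𝟭 (Type u)) (tup Y r)))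
  have h2 : ∀ c : Cat.{u, u}ᵒᵖ, HasColimitsOfSize.{u, u}
      ((diagramContextFunctor.{u} (Comma (𝟭 (Type u)) (tup Y r))).obj c) := fun c =>
    inferInstanceAs (HasColimitsOfSize.{u, u} (c.unop ⥤ Comma (𝟭 (Type u)) (tup Y r)))
  obtain ⟨a1, a2⟩ := BifibData.hasLimitsOfSize.{_, _, _, _, _, _, u, u} d
  obtain ⟨b1, b2⟩ := BifibData.hasColimitsOfSize.{_, _, _, _, _, _, u, u} d
  exact ⟨⟨a1, b1⟩, ⟨a2, b2⟩⟩
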